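/- Let X be a Polish space and Y a standard Borel space. Then the measurable space (B(X,Y), Σ(X,Y)) is standard Borel, i.e., there is a Polish topology on B(X,Y) whose Borel σ-algebra equals Σ(X,Y). -/

import Mathlib

open Set Function Topology

namespace DescColor

/-- A set is *Baire measurable* if it differs from an open set by a meager set. -/
def BaireMSet {X : Type*} [TopologicalSpace X] (S : Set X) : Prop :=
  ∃ U : Set X, IsOpen U ∧ IsMeagre (symmDiff S U)

/-- A function is *Baire measurable* if preimages of measurable (Borel) sets are
Baire measurable. -/
def BaireMFun {X Y : Type*} [TopologicalSpace X] [MeasurableSpace Y] (f : X → Y) : Prop :=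
  ∀ B : Set Y, MeasurableSet B → BaireMSet (f ⁻¹' B)

variable {Γ : Type*}

/-- The shift action of `Γ` on colorings `Γ → ℕ`: `(γ · ω)(δ) = ω (δ γ)`. -/
def shift [Group Γ] (γ : Γ) (ω : Γ → ℕ) : Γ → ℕ := fun δ => ω (δ * γ)

/-- A subshift: a closed shift-invariant set of colorings. -/
def IsSubshift [Group Γ] (Ω : Set (Γ → ℕ)) : Prop :=
  IsClosed Ω ∧ ∀ (γ : Γ), ∀ ω ∈ Ω, shift γ ω ∈ Ω

/-- The coding map `π_f(x)(γ) = f (γ • x)`. -/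
def codingMap [Group Γ] {X : Type*} [MulAction Γ X] (f : X → ℕ) (x : X) : Γ → ℕ :=
  fun γ => f (γ • x)

/-- The action of `Γ` on `X` admits a Baire measurable `Ω`-coloring. -/
def HasBMColoring [Group Γ] (X : Type*) [TopologicalSpace X] [MulAction Γ X]
    (Ω : Set (Γ → ℕ)) : Prop :=
  ∃ f : X → ℕ, BaireMFun f ∧ {x : X | codingMap f x ∈ Ω} ∈ residual X

/-- The action of `Γ` on `X` is generically smooth. -/
def GenSmooth (Γ : Type*) [Group Γ] (X : Type*) [TopologicalSpace X] [MulAction Γ X] : Prop :=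
  ∃ f : X → ℝ, BaireMFun f ∧ ∀ x y : X, f x = f y ↔ ∃ γ : Γ, γ • x = y

/-- The shift action of `Γ` on `ℕ^Γ` admits a Baire measurable `Ω`-coloring. -/
def ShiftHasBMColoring (Γ : Type*) [Group Γ] (Ω : Set (Γ → ℕ)) : Prop :=
  ∃ f : (Γ → ℕ) → ℕ, BaireMFun f ∧
    {ω : Γ → ℕ | (fun γ : Γ => f (shift γ ω)) ∈ Ω} ∈ residual (Γ → ℕ)

/-- A free continuous action of `Γ` on a Polish space. -/
structure FreePolishAction (Γ : Type*) [Group Γ] where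
  X : Type
  ts : TopologicalSpace X
  polish : @PolishSpace X ts
  smul : Γ → X → X
  one_smul' : ∀ x, smul 1 x = x
  mul_smul' : ∀ γ δ x, smul (γ * δ) x = smul γ (smul δ x)
  cont : ∀ γ : Γ, @Continuous X X ts ts (smul γ)
  free : ∀ (γ : Γ) (x : X), smul γ x = x → γ = 1

/-- A free continuous action on a Polish space admits a Baire measurable `Ω`-coloring. -/
def FreePolishAction.HasBMCol [Group Γ] (α : FreePolishAction Γ) (Ω : Set (Γ → ℕ)) : Prop :=
  letI := α.ts
  ∃ f : α.X → ℕ, BaireMFun f ∧ {x : α.X | (fun γ : Γ => f (α.smul γ x)) ∈ Ω} ∈ residual α.X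

/-- A free continuous action on a Polish space is generically smooth. -/
def FreePolishAction.IsGenSmooth [Group Γ] (α : FreePolishAction Γ) : Prop :=
  letI := α.ts
  ∃ f : α.X → ℝ, BaireMFun f ∧ ∀ x y : α.X, f x = f y ↔ ∃ γ : Γ, α.smul γ x = y

/-- A subshift is *hard* if every free continuous action of `Γ` on a Polish space that
admits a Baire measurable `Ω`-coloring is generically smooth. -/
def Hard (Γ : Type*) [Group Γ] (Ω : Set (Γ → ℕ)) : Prop :=
  ∀ α : FreePolishAction Γ, α.HasBMCol Ω → α.IsGenSmooth

/-- A subshift is *easy* if every free continuous action of `Γ` on a Polish space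
admits a Baire measurable `Ω`-coloring. -/
def Easy (Γ : Type*) [Group Γ] (Ω : Set (Γ → ℕ)) : Prop :=
  ∀ α : FreePolishAction Γ, α.HasBMCol Ω

/-- Finite partial colorings of `Γ`: partial maps `Γ ⇀ ℕ` with finite domain. -/
abbrev FPC (Γ : Type*) : Type _ := {φ : Γ → Option ℕ // {γ : Γ | φ γ ≠ none}.Finite}

/-- The domain of a finite partial coloring. -/
def domP (φ : FPC Γ) : Set Γ := {γ : Γ | φ.1 γ ≠ none}

/-- `Fin(Ω)`: the set of finite partial colorings extending to an element of `Ω`. -/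
def FinOf (Ω : Set (Γ → ℕ)) : Set (FPC Γ) :=
  {φ | ∃ ω ∈ Ω, ∀ (γ : Γ) (c : ℕ), φ.1 γ = some c → ω γ = c}

/-- `g : FPC Γ → Bool` codes (the set `Fin(Ω)` of) the subshift `Ω`. -/
def CodesSubshift [Group Γ] (g : FPC Γ → Bool) (Ω : Set (Γ → ℕ)) : Prop :=
  IsSubshift Ω ∧ ∀ φ : FPC Γ, g φ = true ↔ φ ∈ FinOf Ω

/-- The shift action of `Γ` on finite partial colorings: `(γ · φ)(δ) = φ(δγ)`. -/
def shiftP [Group Γ] (γ : Γ) (φ : FPC Γ) : FPC Γ :=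
  ⟨fun δ => φ.1 (δ * γ), by
    apply (φ.2.image fun δ => δ * γ⁻¹).subset
    intro δ hδ
    exact ⟨δ * γ, hδ, by simp⟩⟩

/-- The empty partial coloring. -/
def emptyP (Γ : Type*) : FPC Γ := ⟨fun _ => none, by simp⟩

/-- The union (join) of two partial colorings (values of `φ` take precedence). -/
def joinP (φ ψ : FPC Γ) : FPC Γ :=
  ⟨fun δ => match φ.1 δ with | some c => some c | none => ψ.1 δ, by
    apply (φ.2.union ψ.2).subset
    intro δ hδ
    by_cases h : φ.1 δ = none
    · right
      simp only [mem_setOf_eq, h] at hδ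
      exact hδ
    · exact Or.inl h⟩

/-- The union of a finite list of partial colorings. -/
def joinList (l : List (FPC Γ)) : FPC Γ := l.foldr joinP (emptyP Γ)

/-- `φ[γ, r]`: the restriction of `φ` to the closed ball `B(γ, r)`. -/
noncomputable def restrictBall [MetricSpace Γ] (φ : FPC Γ) (γ : Γ) (r : ℝ) : FPC Γ :=
  ⟨fun δ => if dist γ δ ≤ r then φ.1 δ else none, by
    apply φ.2.subset
    intro δ hδ
    by_cases h : dist γ δ ≤ r
    · simp only [mem_setOf_eq, if_pos h] at hδ
      exact hδ
    · simp only [mem_setOf_eq, if_neg h] at hδ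
      exact absurd rfl hδ⟩

/-- `φ ∪ {(γ, c)}`. -/
def insertP [DecidableEq Γ] (φ : FPC Γ) (γ : Γ) (c : ℕ) : FPC Γ :=
  ⟨fun δ => if δ = γ then some c else φ.1 δ, by
    apply (φ.2.insert γ).subset
    intro δ hδ
    by_cases h : δ = γ
    · exact Or.inl h
    · right
      simp only [mem_setOf_eq, if_neg h] at hδ
      exact hδ⟩

/-- The restriction of a total coloring `ω` to a finite set `S`. -/
def restrictTo [DecidableEq Γ] (ω : Γ → ℕ) (S : Finset Γ) : FPC Γ :=
  ⟨fun δ => if δ ∈ S then some (ω δ) else none, by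
    apply S.finite_toSet.subset
    intro δ hδ
    by_cases h : δ ∈ S
    · exact h
    · simp only [mem_setOf_eq, if_neg h] at hδ
      exact absurd rfl hδ⟩

/-- Post-composition of a partial coloring with `ρ : ℕ → ℕ`. -/
def mapP (ρ : ℕ → ℕ) (φ : FPC Γ) : FPC Γ :=
  ⟨fun δ => (φ.1 δ).map ρ, by
    apply φ.2.subset
    intro δ hδ
    intro h
    simp only [mem_setOf_eq, h] at hδ
    exact hδ rfl⟩

/-- `ψ` is a restriction of `φ`. -/
def IsRestrictionOf (ψ φ : FPC Γ) : Prop := ∀ δ : Γ, ψ.1 δ = none ∨ ψ.1 δ = φ.1 δ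

/-- A `Γ`-ideal: a shift-invariant set of finite partial colorings closed under
restrictions. -/
def IsGammaIdeal [Group Γ] (P : Set (FPC Γ)) : Prop :=
  (∀ (γ : Γ), ∀ φ ∈ P, shiftP γ φ ∈ P) ∧
  (∀ φ ∈ P, ∀ ψ : FPC Γ, IsRestrictionOf ψ φ → ψ ∈ P)

/-- An extendable `Γ`-ideal. -/
def IsExtendable [DecidableEq Γ] (P : Set (FPC Γ)) : Prop :=
  ∀ φ ∈ P, ∀ γ : Γ, φ.1 γ = none → ∃ c : ℕ, insertP φ γ c ∈ P

/-- `φ` and `ψ` are `R`-separated: `dist(dom φ, dom ψ) > R φ + R ψ`. -/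
def RSeparated [MetricSpace Γ] (R : FPC Γ → ℝ) (φ ψ : FPC Γ) : Prop :=
  ∀ γ ∈ domP φ, ∀ δ ∈ domP ψ, R φ + R ψ < dist γ δ

/-- The join property of a `Γ`-ideal `P`. -/
def HasJoinProperty [Group Γ] [MetricSpace Γ] (P : Set (FPC Γ)) : Prop :=
  ∃ R : FPC Γ → ℝ, (∀ φ, 0 ≤ R φ) ∧ (∀ (γ : Γ), ∀ φ ∈ P, R (shiftP γ φ) = R φ) ∧
    ∀ l : List (FPC Γ), (∀ φ ∈ l, φ ∈ P) → l.Pairwise (RSeparated R) → joinList l ∈ P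

/-- `P^loc_r`: partial colorings that are `r`-locally in `P`. -/
def LocallyIn [MetricSpace Γ] (P : Set (FPC Γ)) (r : ℕ → ℝ) : Set (FPC Γ) :=
  {φ | ∀ (γ : Γ) (c : ℕ), φ.1 γ = some c → restrictBall φ γ (r c) ∈ P}

/-- A local `Γ`-ideal. -/
def IsLocal [MetricSpace Γ] (P : Set (FPC Γ)) : Prop :=
  ∃ r : ℕ → ℝ, (∀ c, 0 ≤ r c) ∧ P = LocallyIn P r

/-- `Col(P)`: colorings all of whose finite restrictions lie in `P`. -/
def ColOf [DecidableEq Γ] (P : Set (FPC Γ)) : Set (Γ → ℕ) :=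
  {ω | ∀ S : Finset Γ, restrictTo ω S ∈ P}

/-! ### The space of Baire measurable functions -/

/-- Baire measurable functions from `X` to `Y`. -/
abbrev BMFunSub (X Y : Type*) [TopologicalSpace X] [MeasurableSpace Y] :=
  {f : X → Y // BaireMFun f}

/-- Equality on a comeager set. -/
def BFunRel {X Y : Type*} [TopologicalSpace X] [MeasurableSpace Y]
    (f g : BMFunSub X Y) : Prop := {x : X | f.1 x = g.1 x} ∈ residual X

/-- `B(X,Y)`: Baire measurable functions modulo equality on a comeager set. -/
abbrev BFun (X Y : Type*) [TopologicalSpace X] [MeasurableSpace Y] :=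
  Quot (BFunRel (X := X) (Y := Y))

/-- `[U, A]`: the classes of functions `f` with `U ∖ f⁻¹(A)` meager. -/
def forceSet {X Y : Type*} [TopologicalSpace X] [MeasurableSpace Y]
    (U : Set X) (A : Set Y) : Set (BFun X Y) :=
  {F | ∃ f : BMFunSub X Y, Quot.mk BFunRel f = F ∧ IsMeagre (U \ f.1 ⁻¹' A)}

/-- `Σ(X,Y)`: the σ-algebra generated by the sets `[U, A]` for `U` nonempty open
and `A` Borel. -/
def SigmaXY (X Y : Type*) [TopologicalSpace X] [MeasurableSpace Y] :
    MeasurableSpace (BFun X Y) :=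
  MeasurableSpace.generateFrom
    {S | ∃ (U : Set X) (A : Set Y), IsOpen U ∧ U.Nonempty ∧ MeasurableSet A ∧ S = forceSet U A}

/-! ### Meager sets and Baire measurable sets -/

section BaireCategory

open Filter TopologicalSpace MeasureTheory

variable {X Y : Type*} [TopologicalSpace X]

theorem isMeagre_diff_iff {U D : Set X} :
    IsMeagre (U \ D) ↔ ∀ᶠ x in residual X, x ∈ U → x ∈ D := by
  have h : (U \ D)ᶜ = {x | x ∈ U → x ∈ D} := by
    ext x
    simp only [mem_compl_iff, Set.mem_sdiff, mem_ofPred_eq]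
    tauto
  rw [IsMeagre, h]
  rfl

theorem baireMSet_iff {S : Set X} : BaireMSet S ↔ BaireMeasurableSet S := by
  rw [BaireMeasurableSet.iff_residualEq_isOpen]
  refine exists_congr fun U => and_congr_right fun _ => ?_
  have h : (symmDiff S U)ᶜ = {x | x ∈ S ↔ x ∈ U} := by
    ext x
    simp only [mem_compl_iff, mem_symmDiff, mem_ofPred_eq]
    tauto
  rw [IsMeagre, h, eventuallyEq_set]
  rfl

/-- An open set meets `D` in a meager set iff no basic open subset of it has `D` comeager. -/
theorem isMeagre_inter_iff [SecondCountableTopology X] [BaireSpace X] {U D : Set X}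
    (hU : IsOpen U) (hD : BaireMeasurableSet D) :
    IsMeagre (U ∩ D) ↔ ∀ V : countableBasis X, (V : Set X) ⊆ U → ¬ IsMeagre ((V : Set X) \ D) := by
  constructor
  · intro h V hVU hV
    refine not_isMeagre_of_isOpen (isOpen_of_mem_countableBasis V.2)
      (nonempty_of_mem_countableBasis V.2) ((h.union hV).mono fun x hx => ?_)
    by_cases hxD : x ∈ D
    · exact Or.inl ⟨hVU hx, hxD⟩
    · exact Or.inr ⟨hx, hxD⟩
  · intro h
    obtain ⟨W, hW, hDW⟩ := hD.residualEq_isOpen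
    rw [eventuallyEq_set] at hDW
    have hUW : ∀ x, x ∈ U → x ∉ W := by
      intro x hxU hxW
      obtain ⟨V, hV, _, hVUW⟩ :=
        (isBasis_countableBasis X).exists_subset_of_mem_open
          (show x ∈ U ∩ W from ⟨hxU, hxW⟩) (hU.inter hW)
      refine h ⟨V, hV⟩ (fun y hy => (hVUW hy).1) (isMeagre_diff_iff.2 ?_)
      filter_upwards [hDW] with y hy hyV
      exact hy.2 (hVUW hyV).2
    rw [← compl_compl D, ← sdiff_eq, isMeagre_diff_iff]
    filter_upwards [hDW] with x hx hxU hxD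
    exact hUW x hxU (hx.1 hxD)

/-- Category quantifiers preserve measurability: for a measurable set `D` of pairs, the set of
parameters `t` such that the section `D_t` is comeager in `U` is measurable. -/
theorem measurableSet_isMeagre_diff_section {T : Type*} [MeasurableSpace T] [PolishSpace X]
    [MeasurableSpace X] [BorelSpace X] {D : Set (T × X)} (hD : MeasurableSet D) :
    ∀ {U : Set X}, IsOpen U → MeasurableSet {t | IsMeagre (U \ (Prod.mk t ⁻¹' D))} := by
  have compl_step : ∀ D : Set (T × X), MeasurableSet D →
      (∀ {U : Set X}, IsOpen U → MeasurableSet {t | IsMeagre (U \ (Prod.mk t ⁻¹' D))}) →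
      ∀ {U : Set X}, IsOpen U → MeasurableSet {t | IsMeagre (U \ (Prod.mk t ⁻¹' Dᶜ))} := by
    intro D hD ih U hU
    have h : {t | IsMeagre (U \ (Prod.mk t ⁻¹' Dᶜ))} =
        ⋂ V : countableBasis X, ⋂ _ : (V : Set X) ⊆ U,
          {t | IsMeagre ((V : Set X) \ (Prod.mk t ⁻¹' D))}ᶜ := by
      ext t
      simp only [mem_ofPred_eq, mem_iInter, mem_compl_iff]
      rw [preimage_compl, sdiff_compl]
      exact isMeagre_inter_iff hU (measurable_prodMk_left hD).baireMeasurableSet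
    rw [h]
    exact .iInter fun V => .iInter fun _ => (ih (isOpen_of_mem_countableBasis V.2)).compl
  induction D, hD using MeasurableSpace.induction_on_inter
      (generateFrom_prod (α := T) (β := X)).symm isPiSystem_prod with
  | empty => intro U _; simp
  | basic D hD =>
    intro U _
    obtain ⟨A, hA, B, -, rfl⟩ := hD
    have h : {t | IsMeagre (U \ (Prod.mk t ⁻¹' A ×ˢ B))} =
        {t | (t ∈ A ∧ IsMeagre (U \ B)) ∨ (t ∉ A ∧ IsMeagre U)} := by
      ext t
      by_cases ht : t ∈ A <;> simp [ht]
    rw [h]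
    exact (hA.inter (.const _)).union (hA.compl.inter (.const _))
  | compl D hD ih => exact compl_step D hD ih
  | iUnion D _ hD ih =>
    rw [← compl_compl (⋃ i, D i), compl_iUnion]
    intro U hU
    refine compl_step _ (.iInter fun i => (hD i).compl) (fun {U} hU => ?_) hU
    have h : {t | IsMeagre (U \ (Prod.mk t ⁻¹' ⋂ i, (D i)ᶜ))} =
        ⋂ i, {t | IsMeagre (U \ (Prod.mk t ⁻¹' (D i)ᶜ))} := by
      ext t
      simp only [mem_ofPred_eq, mem_iInter, isMeagre_diff_iff, mem_preimage]
      rw [← eventually_countable_forall]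
      simp only [forall_comm (α := ℕ)]
    rw [h]
    exact .iInter fun i => compl_step _ (hD i) (ih i) hU

end BaireCategory

/-! ### Standard Borel spaces -/

section StandardBorel

open MeasureTheory

/-- The σ-algebra pulled back along an injection with measurable range into a standard Borel
space is standard Borel. -/
theorem standardBorelSpace_comap {α β : Type*} [MeasurableSpace β] [StandardBorelSpace β]
    {f : α → β} (hf : Injective f) (hr : MeasurableSet (range f)) :
    @StandardBorelSpace α (MeasurableSpace.comap f inferInstance) := by
  have := hr.standardBorel
  let := upgradeStandardBorel (range f)
  let e : α ≃ range f := Equiv.ofInjective f hf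
  let : TopologicalSpace α := TopologicalSpace.induced e inferInstance
  let : MeasurableSpace α := MeasurableSpace.comap f inferInstance
  refine ⟨inferInstance, ⟨?_⟩, e.polishSpace_induced⟩
  change MeasurableSpace.comap f _ = @borel α (TopologicalSpace.induced e inferInstance)
  rw [borel_comap, ← eq_borel_upgradeStandardBorel (range f), Subtype.instMeasurableSpace,
    MeasurableSpace.comap_comp]
  rfl

theorem exists_measurableEmbedding_nat_prop (Y : Type*) [MeasurableSpace Y]
    [StandardBorelSpace Y] : ∃ φ : Y → ℕ → Prop, MeasurableEmbedding φ := by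
  refine ⟨fun y k => MeasurableSpace.mapNatBool Y y k = true, Measurable.measurableEmbedding ?_ ?_⟩
  · refine measurable_pi_lambda _ fun k => ?_
    exact (measurable_from_top (f := fun b : Bool => b = true)).comp
      ((measurable_pi_apply k).comp (MeasurableSpace.measurable_mapNatBool Y))
  · intro y z h
    refine MeasurableSpace.injective_mapNatBool Y (funext fun k => Bool.eq_iff_iff.2 ?_)
    exact iff_of_eq (congrFun h k)

end StandardBorel

/-! ### Coding Baire measurable functions -/

section Coding

open Filter TopologicalSpace MeasureTheory

variable {X Y : Type*} [TopologicalSpace X] [MeasurableSpace Y]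

theorem bFunRel_equivalence : Equivalence (BFunRel (X := X) (Y := Y)) where
  refl f := by simp [BFunRel]
  symm {f g} h := by simpa only [BFunRel, eq_comm] using h
  trans {f g h} hfg hgh := by
    filter_upwards [hfg, hgh] with x h₁ h₂
    exact Eq.trans h₁ h₂

theorem mk_mem_forceSet {f : BMFunSub X Y} {U : Set X} {A : Set Y} :
    Quot.mk BFunRel f ∈ forceSet U A ↔ IsMeagre (U \ f.1 ⁻¹' A) := by
  refine ⟨?_, fun h => ⟨f, rfl, h⟩⟩
  rintro ⟨g, hg, h⟩
  rw [isMeagre_diff_iff] at h ⊢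
  filter_upwards [h, (bFunRel_equivalence.quot_mk_eq_iff g f).1 hg] with x h₁ h₂ hx
  rw [mem_preimage, ← show g.1 x = f.1 x from h₂]
  exact h₁ hx

theorem BaireMFun.of_eventuallyEq {Z : Type*} [MeasurableSpace Z] [MeasurableSpace X]
    [BorelSpace X] {φ : Y → Z} (hφ : MeasurableEmbedding φ) {f : X → Y} {g : X → Z}
    (hg : Measurable g) (h : ∀ᶠ x in residual X, φ (f x) = g x) : BaireMFun f := by
  intro B hB
  refine baireMSet_iff.2 ((hg (hφ.measurableSet_image.2 hB)).baireMeasurableSet.congr ?_)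
  rw [eventuallyEq_set]
  filter_upwards [h] with x hx
  rw [mem_preimage, ← hx, hφ.injective.mem_set_image, mem_preimage]

variable [SecondCountableTopology X]

/-- The function `X → (ℕ → Prop)` whose `k`-th coordinate is the indicator of the union of the
basic open sets `U` with `t U k`. -/
def decode (t : countableBasis X → ℕ → Prop) (x : X) (k : ℕ) : Prop :=
  ∃ U : countableBasis X, t U k ∧ x ∈ (U : Set X)

/-- The code of a class in `B(X,Y)`: it records which basic open sets force which coordinates of
the image under `φ`. -/
def encodeBFun (φ : Y → ℕ → Prop) (F : BFun X Y) (U : countableBasis X) (k : ℕ) : Prop :=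
  F ∈ forceSet (U : Set X) {y | φ y k}

theorem measurable_decode [MeasurableSpace X] [BorelSpace X] :
    Measurable fun p : (countableBasis X → ℕ → Prop) × X => decode p.1 p.2 := by
  refine measurable_pi_lambda _ fun k => Measurable.exists fun U => Measurable.and ?_ ?_
  · exact (measurable_pi_apply k).comp ((measurable_pi_apply U).comp measurable_fst)
  · exact measurableSet_setOfPred.1
      (measurable_snd (isOpen_of_mem_countableBasis U.2).measurableSet)

theorem measurableSet_setOf_apply {φ : Y → ℕ → Prop} (hφ : Measurable φ) (k : ℕ) :
    MeasurableSet {y | φ y k} :=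
  measurableSet_setOfPred.2 ((measurable_pi_apply k).comp hφ)

theorem decode_encodeBFun {φ : Y → ℕ → Prop} (hφ : Measurable φ) (f : BMFunSub X Y) :
    ∀ᶠ x in residual X, decode (encodeBFun φ (Quot.mk BFunRel f)) x = φ (f.1 x) := by
  have h : ∀ k, ∀ᶠ x in residual X,
      decode (encodeBFun φ (Quot.mk BFunRel f)) x k ↔ φ (f.1 x) k := by
    intro k
    obtain ⟨W, hW, hfW⟩ :=
      (baireMSet_iff.1 (f.2 _ (measurableSet_setOf_apply hφ k))).residualEq_isOpen
    rw [eventuallyEq_set] at hfW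
    have hforce : ∀ᶠ x in residual X, ∀ U : countableBasis X,
        encodeBFun φ (Quot.mk BFunRel f) U k → x ∈ (U : Set X) → φ (f.1 x) k := by
      rw [eventually_countable_forall]
      intro U
      by_cases hU : encodeBFun φ (Quot.mk BFunRel f) U k
      · filter_upwards [isMeagre_diff_iff.1 (mk_mem_forceSet.1 hU)] with x hx _
        exact hx
      · simp [hU]
    filter_upwards [hfW, hforce] with x hx hxU
    constructor
    · rintro ⟨U, hU, hxmem⟩
      exact hxU U hU hxmem
    · intro hφx
      obtain ⟨V, hV, hxV, hVW⟩ :=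
        (isBasis_countableBasis X).exists_subset_of_mem_open (hx.1 hφx) hW
      refine ⟨⟨V, hV⟩, mk_mem_forceSet.2 (isMeagre_diff_iff.2 ?_), hxV⟩
      filter_upwards [hfW] with y hy hyV
      exact hy.2 (hVW hyV)
  filter_upwards [eventually_countable_forall.2 h] with x hx
  exact funext fun k => propext (hx k)

theorem encodeBFun_injective {φ : Y → ℕ → Prop} (hφ : Measurable φ) (hinj : Injective φ) :
    Injective (encodeBFun (X := X) φ) := by
  rintro ⟨f⟩ ⟨g⟩ h
  refine Quot.sound ?_
  filter_upwards [decode_encodeBFun hφ f, decode_encodeBFun hφ g] with x hf hg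
  refine hinj ?_
  rw [← hf, ← hg]
  exact congrArg (fun t => decode t x) h

theorem mk_mem_forceSet_iff_decode {φ : Y → ℕ → Prop} (hφ : MeasurableEmbedding φ)
    {F : BFun X Y} {U : Set X} {A : Set Y} :
    F ∈ forceSet U A ↔ IsMeagre (U \ decode (encodeBFun φ F) ⁻¹' (φ '' A)) := by
  obtain ⟨f⟩ := F
  refine mk_mem_forceSet.trans ?_
  rw [isMeagre_diff_iff, isMeagre_diff_iff]
  refine eventually_congr ?_
  filter_upwards [decode_encodeBFun hφ.measurable f] with x hx
  rw [mem_preimage, mem_preimage]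
  refine imp_congr_right fun _ => ?_
  rw [← hφ.injective.mem_set_image, ← hx]

theorem range_encodeBFun [BaireSpace X] [MeasurableSpace X] [BorelSpace X]
    {φ : Y → ℕ → Prop} (hφ : MeasurableEmbedding φ) :
    range (encodeBFun (X := X) φ) =
      {t | (∀ (U : countableBasis X) (k : ℕ),
          t U k ↔ IsMeagre ((U : Set X) \ {x | decode t x k})) ∧
        IsMeagre (univ \ decode t ⁻¹' range φ)} := by
  ext t
  constructor
  · rintro ⟨⟨f⟩, rfl⟩
    have hf := decode_encodeBFun hφ.measurable f
    refine ⟨fun U k => mk_mem_forceSet.trans ?_, isMeagre_diff_iff.2 ?_⟩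
    · rw [isMeagre_diff_iff, isMeagre_diff_iff]
      refine eventually_congr ?_
      filter_upwards [hf] with x hx
      refine imp_congr_right fun _ => ?_
      exact iff_of_eq (congrFun hx k).symm
    · filter_upwards [hf] with x hx _
      exact ⟨f.1 x, hx.symm⟩
  · rintro ⟨hreg, hran⟩
    have hran' : ∀ᶠ x in residual X, decode t x ∈ range φ := by
      simpa using isMeagre_diff_iff.1 hran
    obtain ⟨f, hf⟩ : ∃ f : X → Y, ∀ᶠ x in residual X, φ (f x) = decode t x := by
      rcases isEmpty_or_nonempty Y with hY | hY
      · rcases isEmpty_or_nonempty X with hX | hX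
        · exact ⟨isEmptyElim, .of_forall isEmptyElim⟩
        · obtain ⟨x, y, -⟩ := (dense_of_mem_residual hran').nonempty
          exact hY.elim y
      · refine ⟨fun x => invFun φ (decode t x), ?_⟩
        filter_upwards [hran'] with x hx
        exact invFun_eq hx
    have hmeas : Measurable (decode t) := measurable_decode.comp measurable_prodMk_left
    refine ⟨Quot.mk _ ⟨f, .of_eventuallyEq hφ hmeas hf⟩, ?_⟩
    funext U k
    refine propext (mk_mem_forceSet.trans (Iff.trans ?_ (hreg U k).symm))
    rw [isMeagre_diff_iff, isMeagre_diff_iff]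
    refine eventually_congr ?_
    filter_upwards [hf] with x hx
    refine imp_congr_right fun _ => ?_
    exact iff_of_eq (congrFun hx k)

theorem measurableSet_range_encodeBFun {X : Type*} [TopologicalSpace X] [PolishSpace X]
    {φ : Y → ℕ → Prop} (hφ : MeasurableEmbedding φ) :
    MeasurableSet (range (encodeBFun (X := X) φ)) := by
  borelize X
  rw [range_encodeBFun hφ]
  refine MeasurableSet.inter (measurableSet_setOfPred.2 ?_) ?_
  · refine Measurable.forall fun U => Measurable.forall fun k => Measurable.iff ?_ ?_
    · exact (measurable_pi_apply k).comp (measurable_pi_apply U)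
    · exact measurableSet_setOfPred.1 (measurableSet_isMeagre_diff_section
        (measurableSet_setOf_apply measurable_decode k) (isOpen_of_mem_countableBasis U.2))
  · exact measurableSet_isMeagre_diff_section (measurable_decode hφ.measurableSet_range) isOpen_univ

theorem sigmaXY_eq_comap {X : Type*} [TopologicalSpace X] [PolishSpace X]
    {φ : Y → ℕ → Prop} (hφ : MeasurableEmbedding φ) :
    SigmaXY X Y = MeasurableSpace.comap (encodeBFun φ) inferInstance := by
  borelize X
  apply le_antisymm
  · refine MeasurableSpace.generateFrom_le ?_
    rintro _ ⟨U, A, hU, -, hA, rfl⟩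
    refine ⟨_, measurableSet_isMeagre_diff_section
      (measurable_decode (hφ.measurableSet_image.2 hA)) hU, ?_⟩
    ext F
    exact (mk_mem_forceSet_iff_decode hφ).symm
  · rw [← measurable_iff_comap_le]
    let := SigmaXY X Y
    refine measurable_pi_lambda _ fun U => measurable_pi_lambda _ fun k => measurableSet_setOfPred.1 ?_
    exact MeasurableSpace.measurableSet_generateFrom
      ⟨U, _, isOpen_of_mem_countableBasis U.2, nonempty_of_mem_countableBasis U.2,
        measurableSet_setOf_apply hφ.measurable k, rfl⟩

end Coding

/-- The space `B(X,Y)` of Baire measurable functions modulo equality on a comeager set,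
with the σ-algebra `Σ(X,Y)`, is a standard Borel space. -/
theorem stmt3 (X Y : Type*) [TopologicalSpace X] [PolishSpace X]
    [MeasurableSpace Y] [StandardBorelSpace Y] :
    @StandardBorelSpace (BFun X Y) (SigmaXY X Y) := by
  obtain ⟨φ, hφ⟩ := exists_measurableEmbedding_nat_prop Y
  rw [sigmaXY_eq_comap hφ]
  exact standardBorelSpace_comap (encodeBFun_injective hφ.measurable hφ.injective)
    (measurableSet_range_encodeBFun hφ)

end DescColor
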